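/- arXiv:2503.20561 — 3 statements merged into one kernel-verified Lean document; each statement's English description precedes it below -/
import Mathlib

section
/- Let B≥1 and d,p,β∈ℕ+ with d ≥ p+1. Let Θ be any transformer parameters with the emulation property. There exists a constant C'>0 depending only on β and p such that for all T,L,r∈ℕ+ with p ≤ r ≤ d and rL ≥ 2: sup_{f∈C_u^β([0,1]^p)} inf over S ≥ max(d·B^{4L}·T^{2L}, 2L) and H^P∈Q_{U_{d,r}(B)}(T,L,S) of ‖f̂_{Θ,H^P,L,p} − f‖_{L^∞([0,1]^p)} ≥ C'·(r²L²·log(rL))^{−β/p}. -/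
open scoped BigOperators
open Matrix

noncomputable section

namespace PromptTF

/-- The ReLU activation function. -/
def relu (x : ℝ) : ℝ := max x 0

/-- The elementary universal activation function (EUAF). -/
def euaf (x : ℝ) : ℝ :=
  if 0 ≤ x then |x - 2 * (⌊(x + 1) / 2⌋ : ℝ)| else x / (1 + |x|)

/-- Parameters of one transformer layer (attention heads and a feed-forward net). -/
structure TFLayer (D : ℕ) where
  M : ℕ
  Q : Fin M → Matrix (Fin D) (Fin D) ℝ
  K : Fin M → Matrix (Fin D) (Fin D) ℝ
  V : Fin M → Matrix (Fin D) (Fin D) ℝ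
  width : ℕ
  W1 : Matrix (Fin width) (Fin D) ℝ
  W2 : Matrix (Fin D) (Fin width) ℝ

/-- Self-attention layer applied to a list of tokens. -/
def attnOut {D : ℕ} (θ : TFLayer D) (H : List (Fin D → ℝ)) : List (Fin D → ℝ) :=
  H.map fun h => fun i =>
    h i + ∑ m : Fin θ.M,
      (H.map fun h' =>
        relu (dotProduct ((θ.Q m).mulVec h) ((θ.K m).mulVec h')) * ((θ.V m).mulVec h') i).sum

/-- One transformer layer `FFN ∘ Attn`, with feed-forward activation `act`. -/
def layerMap {D : ℕ} (act : ℝ → ℝ) (θ : TFLayer D) (H : List (Fin D → ℝ)) :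
    List (Fin D → ℝ) :=
  (attnOut θ H).map fun h => fun i =>
    h i + (θ.W2.mulVec fun k => act ((θ.W1.mulVec h) k)) i

/-- Multi-layer transformer, all activations ReLU. -/
def tfForward {D : ℕ} (Θ : List (TFLayer D)) (H : List (Fin D → ℝ)) : List (Fin D → ℝ) :=
  Θ.foldl (fun H' θ => layerMap relu θ H') H

/-- Multi-layer transformer whose first feed-forward layer uses the EUAF activation. -/
def tfForwardEUAF {D : ℕ} (Θ : List (TFLayer D)) (H : List (Fin D → ℝ)) :
    List (Fin D → ℝ) :=
  match Θ with
  | [] => H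
  | θ :: rest => rest.foldl (fun H' θ' => layerMap relu θ' H') (layerMap euaf θ H)

/-- Sequential (autoregressive) generation: append the last output column repeatedly. -/
def genTokens {D : ℕ} (forward : List (Fin D → ℝ) → List (Fin D → ℝ))
    (H : List (Fin D → ℝ)) : ℕ → List (Fin D → ℝ)
  | 0 => H
  | v + 1 =>
      genTokens forward H v ++ [(forward (genTokens forward H v)).getLastD (fun _ => 0)]

/-- The token at one-based position `m` in the generated sequence. -/
def tokenAt {D : ℕ} (forward : List (Fin D → ℝ) → List (Fin D → ℝ))
    (H : List (Fin D → ℝ)) (m : ℕ) : Fin D → ℝ :=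
  (genTokens forward H (m - H.length)).getD (m - 1) (fun _ => 0)

/-- A token with word embedding `u`, layer index `w`, position `j` and scale `S`:
`(uᵀ, 0_{3d+4}ᵀ, 1, S, S·w, S·j)ᵀ ∈ ℝ^{4d+8}`. -/
def promptToken (d : ℕ) (u : Fin d → ℝ) (w : ℤ) (j : ℕ) (S : ℝ) : Fin (4 * d + 8) → ℝ :=
  fun i =>
    if h : (i : ℕ) < d then u ⟨i, h⟩
    else if (i : ℕ) = 4 * d + 4 then 1
    else if (i : ℕ) = 4 * d + 5 then S
    else if (i : ℕ) = 4 * d + 6 then S * w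
    else if (i : ℕ) = 4 * d + 7 then S * j
    else 0

/-- First `d` coordinates of a token. -/
def firstd (d : ℕ) (h : Fin (4 * d + 8) → ℝ) : Fin d → ℝ :=
  fun k => h (Fin.castLE (by omega) k)

/-- Initial input: `T` prompt tokens followed by `N` data tokens. -/
def initialInput (d T N : ℕ) (u : Fin T → Fin d → ℝ) (w : Fin T → ℕ) (S : ℝ)
    (z : Fin N → Fin d → ℝ) : List (Fin (4 * d + 8) → ℝ) :=
  ((List.finRange T).map fun j => promptToken d (u j) (w j) ((j : ℕ) + 1) S)
    ++ ((List.finRange N).map fun i => promptToken d (z i) 0 (T + (i : ℕ) + 1) S)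

/-- The closed Euclidean ball of radius `B` in `ℝ^d`. -/
def eball (d : ℕ) (B : ℝ) : Set (Fin d → ℝ) :=
  {v | Real.sqrt (∑ k, v k ^ 2) ≤ B}

/-- Data of a valid prompt in `P_U(T, L, S)`: word embeddings in `U`,
layer indices in `{1, …, 2L}`. -/
def ValidPrompt {d : ℕ} (U : Set (Fin d → ℝ)) (T L : ℕ)
    (u : Fin T → Fin d → ℝ) (w : Fin T → ℕ) : Prop :=
  (∀ j, u j ∈ U) ∧ ∀ j, 1 ≤ w j ∧ w j ≤ 2 * L

/-- The virtual weight matrix `W^P_ℓ` (without the first-layer correction term). -/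
def WPmat {d T : ℕ} (u : Fin T → Fin d → ℝ) (w : Fin T → ℕ) (ℓ : ℕ) :
    Matrix (Fin d) (Fin d) ℝ :=
  ∑ j : Fin T,
    if h : (j : ℕ) + 1 < T then
      (if w j = 2 * ℓ - 1 ∧ w ⟨(j : ℕ) + 1, h⟩ = 2 * ℓ then
        vecMulVec (u j) (u ⟨(j : ℕ) + 1, h⟩) else 0)
    else 0

/-- The first-layer correction term `(h_T)_{1:d} 1{w_T=1} Σ_{j'} (h_{j'})_{1:d}ᵀ 1{w_{j'}=1}`. -/
def WPcorr {d T : ℕ} (u : Fin T → Fin d → ℝ) (w : Fin T → ℕ) :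
    Matrix (Fin d) (Fin d) ℝ :=
  if hT : 0 < T then
    (if w ⟨T - 1, by omega⟩ = 1 then
      vecMulVec (u ⟨T - 1, by omega⟩) (∑ j : Fin T, if w j = 1 then u j else 0)
    else 0)
  else 0

/-- The virtual first-layer weight matrix `W^P_{1,i}`; `first` indicates `i = 1`. -/
def WPone {d T : ℕ} (u : Fin T → Fin d → ℝ) (w : Fin T → ℕ) (first : Bool) :
    Matrix (Fin d) (Fin d) ℝ :=
  WPmat u w 1 + if first then WPcorr u w else 0

/-- The family of virtual weight matrices of a prompt, for the data token with
zero-based index `i`. -/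
def WPfam {d T : ℕ} (u : Fin T → Fin d → ℝ) (w : Fin T → ℕ) (i : ℕ) :
    ℕ → Matrix (Fin d) (Fin d) ℝ :=
  fun ℓ => if ℓ = 1 then WPone u w (i == 0) else WPmat u w ℓ

/-- Output of the virtual network after `ℓ` layers:
`vnetOut … ℓ = W_ℓ act(W_{ℓ-1} act( ⋯ act(W_1 z) ⋯ ))`. -/
def vnetOut (d : ℕ) (act : ℝ → ℝ) (Ws : ℕ → Matrix (Fin d) (Fin d) ℝ)
    (z : Fin d → ℝ) : ℕ → Fin d → ℝ
  | 0 => z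
  | ℓ + 1 =>
      (Ws (ℓ + 1)).mulVec fun k =>
        if ℓ = 0 then vnetOut d act Ws z ℓ k else act (vnetOut d act Ws z ℓ k)

/-- The emulation property: for every admissible prompt and data tokens, the sequentially
generated tokens realize the virtual neural network encoded by the prompt
(with activation `act`). -/
def EmulatesWith (d : ℕ)
    (forward : List (Fin (4 * d + 8) → ℝ) → List (Fin (4 * d + 8) → ℝ))
    (act : ℝ → ℝ) : Prop :=
  ∀ B : ℝ, 1 ≤ B → ∀ T L : ℕ, 0 < T → 0 < L →
  ∀ U : Set (Fin d → ℝ), U ⊆ eball d B →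
  ∀ S : ℝ, max ((d : ℝ) * B ^ (4 * L) * (T : ℝ) ^ (2 * L)) (2 * (L : ℝ)) ≤ S →
  ∀ (u : Fin T → Fin d → ℝ) (w : Fin T → ℕ), ValidPrompt U T L u w →
  ∀ N : ℕ, 0 < N → ∀ z : Fin N → Fin d → ℝ, (∀ i k, z i k ∈ Set.Icc (0 : ℝ) 1) →
  ∀ (i : Fin N) (ℓ : ℕ), 1 ≤ ℓ → ℓ ≤ L →
    tokenAt forward (initialInput d T N u w S z) (T + N * ℓ + (i : ℕ) + 1)
      = promptToken d (vnetOut d act (WPfam u w (i : ℕ)) (z i) ℓ) (-(ℓ : ℤ))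
          (T + N * ℓ + (i : ℕ) + 1) S

/-- The embedding `x ↦ (xᵀ, 1, 0_{d-p-1}ᵀ)ᵀ ∈ ℝ^d` of an input `x ∈ ℝ^p`. -/
def embed (d p : ℕ) (x : Fin p → ℝ) : Fin d → ℝ :=
  fun k => if h : (k : ℕ) < p then x ⟨k, h⟩ else if (k : ℕ) = p then 1 else 0

/-- The function approximator `f̂_{Θ,H^P,L,p}`: first coordinate of the token at
position `T+1+L` generated from the prompt followed by the single data token. -/
def fhat {d : ℕ} (forward : List (Fin (4 * d + 8) → ℝ) → List (Fin (4 * d + 8) → ℝ))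
    {T : ℕ} (u : Fin T → Fin d → ℝ) (w : Fin T → ℕ) (S : ℝ) (L p : ℕ)
    (x : Fin p → ℝ) : ℝ :=
  tokenAt forward (initialInput d T 1 u w S fun _ => embed d p x) (T + 1 + L)
    ⟨0, by omega⟩

/-- The unit cube `[0,1]^p`. -/
def unitCube (p : ℕ) : Set (Fin p → ℝ) := Set.Icc 0 1

/-- The sup-distance `‖f - g‖_{L^∞([0,1]^p)}`. -/
def supDist (p : ℕ) (f g : (Fin p → ℝ) → ℝ) : ℝ :=
  ⨆ x : unitCube p, |f x.1 - g x.1|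

/-- Partial derivative (within the unit cube) in coordinate direction `i`. -/
def pderivW (p : ℕ) (i : Fin p) (f : (Fin p → ℝ) → ℝ) : (Fin p → ℝ) → ℝ :=
  fun x => fderivWithin ℝ f (unitCube p) x (Pi.single i 1)

/-- Iterated partial derivative along a list of coordinate directions. -/
def pderivList (p : ℕ) : List (Fin p) → ((Fin p → ℝ) → ℝ) → (Fin p → ℝ) → ℝ
  | [], f => f
  | i :: is, f => pderivList p is (pderivW p i f)

/-- The unit ball `C_u^β([0,1]^p)` of `β`-times continuously differentiable functions with
all partial derivatives of order `≤ β` bounded by `1` on the cube. -/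
def Hclass (p β : ℕ) : Set ((Fin p → ℝ) → ℝ) :=
  {f | ContDiffOn ℝ β f (unitCube p) ∧
    ∀ ls : List (Fin p), ls.length ≤ β →
      ∀ x ∈ unitCube p, |pderivList p ls f x| ≤ 1}

/-- `U_{d,r}` : the span of the first `r` standard basis vectors of `ℝ^d`. -/
def spanFirst (d r : ℕ) : Set (Fin d → ℝ) :=
  {v | ∀ k : Fin d, r ≤ (k : ℕ) → v k = 0}

/-- Hidden layers of a standard ReLU network of width `r` (with biases). -/
def nnHidden {p r : ℕ} (W0 : Matrix (Fin r) (Fin p) ℝ) (b0 : Fin r → ℝ)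
    (Wm : ℕ → Matrix (Fin r) (Fin r) ℝ) (bm : ℕ → Fin r → ℝ) (x : Fin p → ℝ) :
    ℕ → Fin r → ℝ
  | 0 => fun i => W0.mulVec x i + b0 i
  | k + 1 => fun i =>
      (Wm k).mulVec (fun j => relu (nnHidden W0 b0 Wm bm x k j)) i + bm k i

/-- The class `N(r,p,L)` of ReLU networks `ℝ^p → ℝ` of width `r` and depth `L`
(`L` affine maps with ReLU in between). -/
def NNclass (r p L : ℕ) : Set ((Fin p → ℝ) → ℝ) :=
  {f | if L = 1 then ∃ (a : Fin p → ℝ) (b : ℝ), f = fun x => (∑ i, a i * x i) + b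
    else ∃ (W0 : Matrix (Fin r) (Fin p) ℝ) (b0 : Fin r → ℝ)
      (Wm : ℕ → Matrix (Fin r) (Fin r) ℝ) (bm : ℕ → Fin r → ℝ)
      (wL : Fin r → ℝ) (bL : ℝ),
      f = fun x => (∑ j, wL j * relu (nnHidden W0 b0 Wm bm x (L - 2) j)) + bL}

/-- Operator norm (w.r.t. the Euclidean norm) of a `d × d` matrix. -/
def opNorm {d : ℕ} (W : Matrix (Fin d) (Fin d) ℝ) : ℝ :=
  ‖LinearMap.toContinuousLinearMap (Matrix.toEuclideanLin W)‖

/-- The class `W(r,d,U,B)` of coarse weight matrices. -/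
def coarseW (d r : ℕ) (U : Set (Fin d → ℝ)) (B : ℝ) :
    Set (Matrix (Fin d) (Fin d) ℝ) :=
  {W | (∃ ut uu : Fin r → Fin d → ℝ,
        (∀ k, ut k ∈ U) ∧ (∀ k, uu k ∈ U) ∧ W = ∑ k, vecMulVec (ut k) (uu k)) ∧
    opNorm W ≤ B ^ 2}

open Classical in
/-- Number of nonzero parameter entries of one transformer layer. -/
def layerNonzero {D : ℕ} (θ : TFLayer D) : ℕ :=
  (Finset.univ.filter fun p : Fin θ.M × Fin D × Fin D => θ.Q p.1 p.2.1 p.2.2 ≠ 0).card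
  + (Finset.univ.filter fun p : Fin θ.M × Fin D × Fin D => θ.K p.1 p.2.1 p.2.2 ≠ 0).card
  + (Finset.univ.filter fun p : Fin θ.M × Fin D × Fin D => θ.V p.1 p.2.1 p.2.2 ≠ 0).card
  + (Finset.univ.filter fun p : Fin θ.width × Fin D => θ.W1 p.1 p.2 ≠ 0).card
  + (Finset.univ.filter fun p : Fin D × Fin θ.width => θ.W2 p.1 p.2 ≠ 0).card

/-- Total number of nonzero parameter entries of a transformer. -/
def tfNonzero {D : ℕ} (Θ : List (TFLayer D)) : ℕ := (Θ.map layerNonzero).sum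

/-- All parameter entries of one layer bounded in absolute value by `c`. -/
def layerEntriesBounded {D : ℕ} (θ : TFLayer D) (c : ℝ) : Prop :=
  (∀ m i j, |θ.Q m i j| ≤ c) ∧ (∀ m i j, |θ.K m i j| ≤ c) ∧ (∀ m i j, |θ.V m i j| ≤ c)
  ∧ (∀ i j, |θ.W1 i j| ≤ c) ∧ ∀ i j, |θ.W2 i j| ≤ c

end PromptTF
end

open PromptTF Matrix

/-- A polynomial grows at most like the power of the norm given by its total degree. -/
theorem MvPolynomial.exists_abs_eval_le {ι : Type*} [Fintype ι] (P : MvPolynomial ι ℝ) :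
    ∃ C : ℝ, 0 < C ∧ ∀ x : ι → ℝ, |eval x P| ≤ C * max 1 ‖x‖ ^ P.totalDegree := by
  refine ⟨∑ s ∈ P.support, |P.coeff s| + 1, by positivity, fun x => ?_⟩
  have h1 : (1 : ℝ) ≤ max 1 ‖x‖ := le_max_left _ _
  have hterm : ∀ s ∈ P.support, |P.coeff s * ∏ i, x i ^ s i|
      ≤ |P.coeff s| * max 1 ‖x‖ ^ P.totalDegree := by
    intro s hs
    rw [abs_mul, Finset.abs_prod]
    gcongr
    calc ∏ i, |x i ^ s i| ≤ ∏ i, max 1 ‖x‖ ^ s i := by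
          refine Finset.prod_le_prod (fun _ _ => abs_nonneg _) fun i _ => ?_
          rw [abs_pow]
          gcongr
          exact (norm_le_pi_norm x i).trans (le_max_right _ _)
      _ = max 1 ‖x‖ ^ ∑ i, s i := Finset.prod_pow_eq_pow_sum _ _ _
      _ ≤ _ := by
          refine pow_le_pow_right₀ h1 ?_
          have := le_totalDegree hs
          rwa [Finsupp.sum_fintype _ _ fun _ => rfl] at this
  rw [eval_eq', add_mul, Finset.sum_mul]
  exact (Finset.abs_sum_le_sum_abs _ _).trans
    ((Finset.sum_le_sum hterm).trans (le_add_of_nonneg_right (by positivity)))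

theorem MvPolynomial.totalDegree_pderiv_le {ι : Type*} (i : ι) (P : MvPolynomial ι ℝ) :
    (pderiv i P).totalDegree ≤ P.totalDegree := by
  refine Finset.sup_le fun s hs => ?_
  rw [mem_support_iff, coeff_pderiv] at hs
  have := le_totalDegree (mem_support_iff.2 (left_ne_zero_of_mul hs))
  rw [Finsupp.sum_add_index' (fun _ => rfl) (fun _ _ _ => rfl)] at this
  exact (Nat.le_add_right _ _).trans this

theorem MvPolynomial.hasDerivAt_eval_update {ι : Type*} [DecidableEq ι] (P : MvPolynomial ι ℝ)
    (x : ι → ℝ) (i : ι) :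
    HasDerivAt (fun t => eval (Function.update x i t) P) (eval x (pderiv i P)) (x i) := by
  induction P using MvPolynomial.induction_on with
  | C a => simpa using hasDerivAt_const (x i) a
  | add p q hp hq => simpa using HasDerivAt.fun_add hp hq
  | mul_X p j hp =>
    have hX : HasDerivAt (fun t => Function.update x i t j) (if j = i then 1 else 0) (x i) := by
      by_cases h : j = i
      · subst h; simpa using hasDerivAt_id' (x j)
      · simpa [h] using hasDerivAt_const (x i) (x j)
    have := HasDerivAt.fun_mul hp hX
    simp only [Function.update_eq_self] at this
    have hval : eval x (pderiv i (p * X j))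
        = eval x (pderiv i p) * x j + eval x p * if j = i then 1 else 0 := by
      simp only [pderiv_mul, map_mul, map_add, eval_X, pderiv_X, Pi.single_apply]
      split_ifs <;> simp
    simpa only [map_mul, eval_X, hval] using this

/-- A system `xᵢ ^ e = gᵢ x` with `deg gᵢ < e` in `n` variables has at most `e ^ n` solutions. -/
theorem MvPolynomial.card_le_of_pow_eq_eval {ι : Type*} [Fintype ι] (e : ℕ)
    (g : ι → MvPolynomial ι ℝ) (hg : ∀ i, (g i).totalDegree < e) (Z : Finset (ι → ℝ))
    (hZ : ∀ x ∈ Z, ∀ i, x i ^ e = eval x (g i)) : Z.card ≤ e ^ Fintype.card ι := by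
  classical
  let Φ : (Z → ℝ) →ₗ[ℝ] ((ι → Fin e) → ℝ) :=
    { toFun := fun c s => ∑ z : Z, c z * ∏ i, z.1 i ^ (s i : ℕ)
      map_add' := fun c c' => by ext s; simp [add_mul, Finset.sum_add_distrib]
      map_smul' := fun a c => by ext s; simp [mul_assoc, Finset.mul_sum] }
  have hΦ : Function.Injective Φ := by
    rw [injective_iff_map_eq_zero]
    intro c hc
    have key : ∀ N : ℕ, ∀ P : MvPolynomial ι ℝ, P.totalDegree ≤ N →
        ∑ z : Z, c z * eval z.1 P = 0 := by
      intro N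
      induction N using Nat.strong_induction_on with
      | _ N ih =>
        have hmon : ∀ s : ι →₀ ℕ, (s.sum fun _ k => k) ≤ N →
            ∑ z : Z, c z * ∏ i, z.1 i ^ s i = 0 := by
          intro s hs
          by_cases hsm : ∀ i, s i < e
          · exact congrFun hc fun i => ⟨s i, hsm i⟩
          · push Not at hsm
            obtain ⟨i, hi⟩ := hsm
            have hdec : s = (s - Finsupp.single i e) + Finsupp.single i e :=
              (tsub_add_cancel_of_le (Finsupp.single_le_iff.2 hi)).symm
            set s' := s - Finsupp.single i e with hs'
            have hdeg : (s.sum fun _ k => k) = (s'.sum fun _ k => k) + e := by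
              rw [hdec, Finsupp.sum_add_index' (fun _ => rfl) (fun _ _ _ => rfl),
                Finsupp.sum_single_index rfl]
            have hlt : (monomial s' (1 : ℝ) * g i).totalDegree < N := by
              refine (totalDegree_mul _ _).trans_lt ?_
              rw [totalDegree_monomial _ one_ne_zero]
              have := hg i
              omega
            have := ih _ hlt _ le_rfl
            rw [← this]
            refine Finset.sum_congr rfl fun z _ => ?_
            congr 1
            rw [map_mul, ← hZ z.1 z.2 i, eval_monomial, one_mul,
              Finsupp.prod_fintype _ _ fun _ => pow_zero _]
            conv_lhs => rw [hdec]
            simp only [Finsupp.add_apply, pow_add, Finset.prod_mul_distrib]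
            congr 1
            rw [Finset.prod_eq_single i]
            · simp
            · intro j _ hj; simp [hj.symm]
            · simp
        intro P hP
        simp_rw [eval_eq', Finset.mul_sum]
        rw [Finset.sum_comm]
        refine Finset.sum_eq_zero fun s hs => ?_
        have := hmon s ((le_totalDegree hs).trans hP)
        calc _ = P.coeff s * ∑ z : Z, c z * ∏ i, z.1 i ^ s i := by
              rw [Finset.mul_sum]; exact Finset.sum_congr rfl fun _ _ => by ring
          _ = 0 := by rw [this, mul_zero]
    have hli := linearIndependent_monoidHom (MvPolynomial ι ℝ) ℝ
    have hinj : Function.Injective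
        fun z : Z => ((eval z.1 : MvPolynomial ι ℝ →+* ℝ) : MvPolynomial ι ℝ →* ℝ) := by
      intro z z' h
      ext i
      simpa using DFunLike.congr_fun h (X i)
    have := Fintype.linearIndependent_iff.1 (hli.comp _ hinj) c (by
      ext P
      simpa using key _ P le_rfl)
    ext z
    exact this z
  have := LinearMap.finrank_le_finrank_of_injective hΦ
  simpa using this

open Filter Topology in
/-- Every sign condition met by polynomials without zeros on `A` is met at a critical point of one
perturbed polynomial, of which there are few. -/
theorem MvPolynomial.exists_finset_sign {ι α J : Type*} [Fintype ι] [Fintype J] (D : ℕ)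
    (f : J → MvPolynomial ι ℝ) (hf : ∀ j, (f j).totalDegree ≤ D) (A : Finset α) (x : α → ι → ℝ)
    (hx : ∀ a ∈ A, ∀ j, eval (x a) (f j) ≠ 0) :
    ∃ Z : Finset (ι → ℝ), Z.card ≤ (2 * (Fintype.card J * D) + 1) ^ Fintype.card ι ∧
      ∀ a ∈ A, ∃ y ∈ Z, ∀ j, 0 < eval (x a) (f j) * eval y (f j) := by
  classical
  set N := Fintype.card J * D with hN
  set P : MvPolynomial ι ℝ := ∏ j, f j ^ 2 with hP
  have hPdeg : P.totalDegree ≤ 2 * N := by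
    refine (totalDegree_finsetProd _ _).trans ?_
    calc ∑ j, (f j ^ 2).totalDegree ≤ ∑ _j : J, 2 * D :=
          Finset.sum_le_sum fun j _ => (totalDegree_pow _ _).trans (by gcongr; exact hf j)
      _ = 2 * N := by simp [hN]; ring
  have hPeval : ∀ y, eval y P = ∏ j, eval y (f j) ^ 2 := fun y => by simp [hP, map_prod]
  let R : (ι → ℝ) → ℝ := fun y => ∑ i, y i ^ (2 * N + 2)
  have hRcont : Continuous R := by fun_prop
  have hR0 : ∀ y i, y i ^ (2 * N + 2) ≤ R y := fun y i =>
    Finset.single_le_sum (f := fun i => y i ^ (2 * N + 2))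
      (fun i _ => (Even.pow_nonneg ⟨N + 1, by ring⟩ _)) (Finset.mem_univ i)
  obtain ⟨ε, hε, hεA⟩ : ∃ ε : ℝ, 0 < ε ∧ ∀ a ∈ A, 0 < eval (x a) P - ε * R (x a) := by
    have h1 : ∀ᶠ ε : ℝ in 𝓝[>] 0, ∀ a ∈ A, 0 < eval (x a) P - ε * R (x a) := by
      rw [Filter.eventually_all_finset]
      intro a ha
      have hpos : 0 < eval (x a) P := by
        rw [hPeval]
        exact Finset.prod_pos fun j _ => sq_pos_of_ne_zero (hx a ha j)
      have : Tendsto (fun ε : ℝ => eval (x a) P - ε * R (x a)) (𝓝[>] 0)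
          (𝓝 (eval (x a) P - 0 * R (x a))) :=
        (Continuous.tendsto (by fun_prop) 0).mono_left nhdsWithin_le_nhds
      exact this.eventually (lt_mem_nhds (by simpa using hpos))
    obtain ⟨ε, h, hε⟩ := (h1.and self_mem_nhdsWithin).exists
    exact ⟨ε, hε, h⟩
  let F : (ι → ℝ) → ℝ := fun y => eval y P - ε * R y
  have hFcont : Continuous F := (continuous_eval P).sub (continuous_const.mul hRcont)
  obtain ⟨c, hc, hCP⟩ := exists_abs_eval_le P
  have hbdd : ∀ y, 0 ≤ F y → ‖y‖ ≤ max 1 (c / ε) := by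
    intro y hy
    by_contra! hlt
    have h1 : 1 < ‖y‖ := (le_max_left _ _).trans_lt hlt
    have h2 : c / ε < ‖y‖ := (le_max_right _ _).trans_lt hlt
    have hRy : ‖y‖ ^ (2 * N + 2) ≤ R y := by
      have : Nonempty ι := by
        by_contra hne
        rw [not_nonempty_iff] at hne
        simp [Subsingleton.elim y 0] at h1
        linarith
      obtain ⟨i, hi⟩ := Finite.exists_max fun i => ‖y i‖
      replace hi : ‖y i‖ = ‖y‖ := le_antisymm (norm_le_pi_norm y i)
        ((pi_norm_le_iff_of_nonempty _).2 hi)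
      rw [← hi, Real.norm_eq_abs, Even.pow_abs ⟨N + 1, by ring⟩]
      exact hR0 y i
    have hPy : eval y P ≤ c * ‖y‖ ^ (2 * N) := by
      refine (le_abs_self _).trans ((hCP y).trans ?_)
      rw [max_eq_right h1.le]
      gcongr
      exact h1.le
    have h3 : ε * ‖y‖ ^ (2 * N + 2) ≤ c * ‖y‖ ^ (2 * N) := by
      have : ε * ‖y‖ ^ (2 * N + 2) ≤ ε * R y := by gcongr
      have : 0 ≤ eval y P - ε * R y := hy
      linarith
    have h4 : ε * ‖y‖ ^ 2 ≤ c := by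
      have hpos : 0 < ‖y‖ ^ (2 * N) := by positivity
      refine le_of_mul_le_mul_right ?_ hpos
      calc _ = ε * ‖y‖ ^ (2 * N + 2) := by ring
        _ ≤ _ := h3
    rw [div_lt_iff₀ hε] at h2
    nlinarith
  have hcrit : ∀ a ∈ A, ∃ y : ι → ℝ, (∀ j, 0 < eval (x a) (f j) * eval y (f j)) ∧
      ∀ i, y i ^ (2 * N + 1) = eval y (C (ε * (2 * N + 2))⁻¹ * pderiv i P) := by
    intro a ha
    let K : Set (ι → ℝ) := {y | 0 ≤ F y ∧ ∀ j, 0 ≤ eval (x a) (f j) * eval y (f j)}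
    have hKclosed : IsClosed K := by
      have hK : K = {y | 0 ≤ F y} ∩ ⋂ j, {y | 0 ≤ eval (x a) (f j) * eval y (f j)} := by
        ext y; simp [K]
      rw [hK]
      exact (isClosed_le continuous_const hFcont).inter (isClosed_iInter fun j =>
        isClosed_le continuous_const (continuous_const.mul (continuous_eval _)))
    have hKcompact : IsCompact K := by
      refine (isCompact_closedBall (0 : ι → ℝ) (max 1 (c / ε))).of_isClosed_subset hKclosed ?_
      intro y hy
      rw [mem_closedBall_zero_iff]
      exact hbdd y hy.1
    have haK : x a ∈ K := ⟨(hεA a ha).le, fun j => mul_self_nonneg _⟩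
    obtain ⟨y, hyK, hymax⟩ := hKcompact.exists_isMaxOn ⟨_, haK⟩ hFcont.continuousOn
    have hFy : 0 < F y := (hεA a ha).trans_le (hymax haK)
    have hne : ∀ j, eval y (f j) ≠ 0 := by
      intro j hj
      have hP0 : eval y P = 0 := by
        rw [hPeval]
        exact Finset.prod_eq_zero (Finset.mem_univ j) (by simp [hj])
      have hRy : 0 ≤ R y := Finset.sum_nonneg fun i _ => Even.pow_nonneg ⟨N + 1, by ring⟩ _
      have : 0 < eval y P - ε * R y := hFy
      nlinarith
    have hpos : ∀ j, 0 < eval (x a) (f j) * eval y (f j) := fun j =>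
      lt_of_le_of_ne (hyK.2 j) (mul_ne_zero (hx a ha j) (hne j)).symm
    have hnhds : K ∈ 𝓝 y := by
      have h1 : ∀ᶠ z in 𝓝 y, 0 < F z := hFcont.continuousAt.eventually (lt_mem_nhds hFy)
      have h2 : ∀ᶠ z in 𝓝 y, ∀ j, 0 < eval (x a) (f j) * eval z (f j) := by
        rw [Filter.eventually_all]
        exact fun j => (continuous_const.mul (continuous_eval (f j))).continuousAt.eventually
          (lt_mem_nhds (hpos j))
      filter_upwards [h1, h2] with z hz1 hz2
      exact ⟨hz1.le, fun j => (hz2 j).le⟩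
    have hloc : IsLocalMax F y := hymax.isLocalMax hnhds
    refine ⟨y, hpos, fun i => ?_⟩
    have hRd : HasDerivAt (fun t => R (Function.update y i t))
        (((2 * N + 2 : ℕ) : ℝ) * y i ^ (2 * N + 1)) (y i) := by
      have hsplit : (fun t => R (Function.update y i t)) = fun t =>
          t ^ (2 * N + 2) + ∑ k ∈ Finset.univ.erase i, y k ^ (2 * N + 2) := by
        ext t
        simp only [R]
        rw [← Finset.add_sum_erase _ _ (Finset.mem_univ i), Function.update_self]
        congr 1
        refine Finset.sum_congr rfl fun k hk => ?_
        rw [Function.update_of_ne (Finset.ne_of_mem_erase hk)]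
      rw [hsplit]
      simpa using (hasDerivAt_pow (2 * N + 2) (y i)).add_const
        (∑ k ∈ Finset.univ.erase i, y k ^ (2 * N + 2))
    have hd : HasDerivAt (fun t => F (Function.update y i t)) _ (y i) :=
      (hasDerivAt_eval_update P y i).sub (hRd.const_mul ε)
    have hloc' : IsLocalMax (fun t => F (Function.update y i t)) (y i) := by
      have hc : ContinuousAt (fun t => Function.update y i t) (y i) := by fun_prop
      have ht : Tendsto (fun t => Function.update y i t) (𝓝 (y i)) (𝓝 y) := by
        simpa [ContinuousAt] using hc
      have := ht.eventually hloc
      simpa [IsLocalMax, IsMaxFilter] using this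
    have h0 := hloc'.hasDerivAt_eq_zero hd
    rw [map_mul, eval_C]
    have hden : ε * (2 * N + 2) ≠ 0 := by positivity
    rw [eq_inv_mul_iff_mul_eq₀ hden]
    push_cast at h0
    linarith
  choose! y hy1 hy2 using hcrit
  refine ⟨A.image y, ?_, fun a ha => ⟨y a, Finset.mem_image_of_mem _ ha, hy1 a ha⟩⟩
  refine card_le_of_pow_eq_eval (2 * N + 1)
    (fun i => C (ε * (2 * N + 2))⁻¹ * pderiv i P) (fun i => ?_) _ ?_
  · refine Nat.lt_succ_of_le ((totalDegree_mul _ _).trans ?_)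
    rw [totalDegree_C, zero_add]
    exact (totalDegree_pderiv_le i P).trans hPdeg
  · simp only [Finset.mem_image]
    rintro _ ⟨a, ha, rfl⟩
    exact hy2 a ha

open Filter Topology in
/-- Few sign conditions are met by few polynomials of low degree in few variables: a definite
proportion of any finite family of points shares the same one. -/
theorem MvPolynomial.exists_subset_sign_const {ι α J : Type*} [Fintype ι] [Fintype J] (D : ℕ)
    (f : J → MvPolynomial ι ℝ) (hf : ∀ j, (f j).totalDegree ≤ D) (A : Finset α)
    (x : α → ι → ℝ) :
    ∃ A' ⊆ A, A.card ≤ A'.card * (2 * (Fintype.card J * D) + 1) ^ Fintype.card ι ∧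
      ∀ a ∈ A', ∀ b ∈ A', ∀ j, 0 < eval (x a) (f j) ↔ 0 < eval (x b) (f j) := by
  classical
  rcases A.eq_empty_or_nonempty with rfl | ⟨a₀, ha₀⟩
  · exact ⟨∅, by simp⟩
  obtain ⟨δ, hδ, hδA⟩ : ∃ δ : ℝ, 0 < δ ∧
      ∀ a ∈ A, ∀ j, 0 < eval (x a) (f j) → δ < eval (x a) (f j) := by
    have h1 : ∀ᶠ δ : ℝ in 𝓝[>] 0, ∀ a ∈ A, ∀ j,
        0 < eval (x a) (f j) → δ < eval (x a) (f j) := by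
      rw [Filter.eventually_all_finset]
      intro a _
      rw [Filter.eventually_all]
      intro j
      by_cases h : 0 < eval (x a) (f j)
      · exact ((gt_mem_nhds h).filter_mono nhdsWithin_le_nhds).mono fun _ h' _ => h'
      · simp [h]
    obtain ⟨δ, h, hδ⟩ := (h1.and self_mem_nhdsWithin).exists
    exact ⟨δ, hδ, h⟩
  have hsign : ∀ a ∈ A, ∀ j, eval (x a) (f j - C δ) ≠ 0 ∧
      (0 < eval (x a) (f j) ↔ 0 < eval (x a) (f j - C δ)) := by
    intro a ha j
    simp only [map_sub, eval_C, sub_pos]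
    by_cases h : 0 < eval (x a) (f j)
    · have := hδA a ha j h
      exact ⟨by linarith, by simp [h, this]⟩
    · exact ⟨by linarith, ⟨fun h' => absurd h' h, fun h' => hδ.trans h'⟩⟩
  obtain ⟨Z, hZcard, hZ⟩ := exists_finset_sign D (fun j => f j - C δ)
    (fun j => (totalDegree_sub_C_le _ _).trans (hf j)) A x fun a ha j => (hsign a ha j).1
  choose! y hyZ hy using hZ
  obtain ⟨z, -, hz⟩ := Finset.exists_max_image Z (fun z => (A.filter fun a => y a = z).card)
    ⟨_, hyZ a₀ ha₀⟩
  refine ⟨A.filter fun a => y a = z, Finset.filter_subset _ _, ?_, ?_⟩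
  · refine (Finset.card_le_mul_card_image_of_maps_to hyZ _ hz).trans ?_
    gcongr
  · simp only [Finset.mem_filter]
    rintro a ⟨ha, hya⟩ b ⟨hb, hyb⟩ j
    rw [(hsign a ha j).2, (hsign b hb j).2]
    have h1 := hy a ha j
    have h2 := hy b hb j
    rw [hya] at h1
    rw [hyb] at h2
    constructor
    · intro h
      have := pos_of_mul_pos_right h1 h.le
      exact pos_of_mul_pos_left h2 this.le
    · intro h
      have := pos_of_mul_pos_right h2 h.le
      exact pos_of_mul_pos_left h1 this.le

/-- After discarding all but a definite proportion of the networks in `A`, the pre-activations of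
the first layers are polynomials of low degree in the weights. -/
theorem exists_subset_vnetOut_eq_eval {r L : ℕ} {α κ : Type*} [Fintype κ] (A : Finset α)
    (Ws : α → ℕ → Matrix (Fin r) (Fin r) ℝ) (z : κ → Fin r → ℝ) (ℓ : ℕ) (hℓ : ℓ + 1 ≤ L) :
    ∃ A' ⊆ A, A.card ≤ A'.card *
        ((2 * (Fintype.card κ * r * L) + 1) ^ (L * (r * r))) ^ ℓ ∧
      ∃ P : κ → Fin r → MvPolynomial (Fin L × Fin r × Fin r) ℝ,
        (∀ k i, (P k i).totalDegree ≤ ℓ + 1) ∧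
        ∀ a ∈ A', ∀ k i, vnetOut r relu (Ws a) (z k) (ℓ + 1) i
          = MvPolynomial.eval (fun t => Ws a (t.1 + 1) t.2.1 t.2.2) (P k i) := by
  classical
  induction ℓ with
  | zero =>
    refine ⟨A, subset_rfl, by simp,
      fun k i => ∑ j, MvPolynomial.C (z k j) * MvPolynomial.X (⟨0, by omega⟩, i, j),
      fun k i => ?_, fun a _ k i => ?_⟩
    · refine MvPolynomial.totalDegree_finsetSum_le fun j _ =>
        (MvPolynomial.totalDegree_mul _ _).trans ?_
      simp
    · simp [vnetOut, mulVec, dotProduct, mul_comm]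
  | succ ℓ ih =>
    obtain ⟨A', hA', hcard, P, hdeg, hP⟩ := ih (by omega)
    obtain ⟨A'', hA'', hcard', hsign⟩ := MvPolynomial.exists_subset_sign_const L
      (fun t : κ × Fin r => P t.1 t.2) (fun t => (hdeg _ _).trans (by omega)) A'
      (fun a t => Ws a (t.1 + 1) t.2.1 t.2.2)
    refine ⟨A'', hA''.trans hA', ?_, fun k i => ∑ j,
      (if ∃ a ∈ A'', 0 < MvPolynomial.eval (fun t => Ws a (t.1 + 1) t.2.1 t.2.2) (P k j) then
        P k j else 0) * MvPolynomial.X (⟨ℓ + 1, by omega⟩, i, j), fun k i => ?_,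
      fun a ha k i => ?_⟩
    · simp only [Fintype.card_prod, Fintype.card_fin] at hcard'
      calc A.card ≤ _ := hcard
        _ ≤ _ := Nat.mul_le_mul_right _ hcard'
        _ = _ := by rw [pow_succ]; ring
    · refine MvPolynomial.totalDegree_finsetSum_le fun j _ =>
        (MvPolynomial.totalDegree_mul _ _).trans ?_
      rw [MvPolynomial.totalDegree_X]
      split_ifs
      · exact Nat.succ_le_succ (hdeg k j)
      · simp
    · rw [vnetOut, map_sum, mulVec, dotProduct]
      refine Finset.sum_congr rfl fun j _ => ?_
      rw [if_neg (Nat.succ_ne_zero ℓ), hP a (hA'' ha) k j, map_mul, MvPolynomial.eval_X, mul_comm]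
      congr 1
      split_ifs with h
      · obtain ⟨b, hb, hpos⟩ := h
        exact max_eq_left ((hsign b hb a ha (k, j)).1 hpos).le
      · push Not at h
        rw [map_zero]
        exact max_eq_right (h a ha)

/-- If networks of depth `L` and width `r` realize all sign patterns on the points `z k`, then the
number of points is bounded. -/
theorem two_pow_card_le_of_vnetOut_pos_iff {r L : ℕ} {κ : Type*} [Fintype κ] (hL : 0 < L)
    (Ws : (κ → Bool) → ℕ → Matrix (Fin r) (Fin r) ℝ) (z : κ → Fin r → ℝ) (i : Fin r)
    (h : ∀ s k, 0 < vnetOut r relu (Ws s) (z k) L i ↔ s k = true) :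
    2 ^ Fintype.card κ ≤
      ((2 * (Fintype.card κ * r * L) + 1) ^ (L * (r * r))) ^ L := by
  classical
  obtain ⟨ℓ, rfl⟩ : ∃ ℓ, L = ℓ + 1 := ⟨L - 1, by omega⟩
  obtain ⟨A', -, hcard, P, hdeg, hP⟩ :=
    exists_subset_vnetOut_eq_eval (L := ℓ + 1) Finset.univ Ws z ℓ le_rfl
  obtain ⟨A'', hA'', hcard', hsign⟩ := MvPolynomial.exists_subset_sign_const (ℓ + 1)
    (fun t : κ × Fin r => P t.1 t.2) (fun t => hdeg _ _) A'
    (fun s t => Ws s (t.1 + 1) t.2.1 t.2.2)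
  have hone : A''.card ≤ 1 := by
    refine Finset.card_le_one.2 fun s hs s' hs' => ?_
    ext k
    have := hsign s hs s' hs' (k, i)
    simp only at this
    rw [← hP s (hA'' hs), ← hP s' (hA'' hs'), h, h] at this
    exact Bool.eq_iff_iff.2 this
  simp only [Fintype.card_prod, Fintype.card_fin] at hcard'
  calc 2 ^ Fintype.card κ = (Finset.univ : Finset (κ → Bool)).card := by simp
    _ ≤ _ := hcard
    _ ≤ _ := Nat.mul_le_mul_right _ hcard'
    _ ≤ _ := Nat.mul_le_mul_right _ (Nat.mul_le_mul_right _ hone)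
    _ = _ := by rw [pow_succ]; ring

/-- Only the leading block of the weights matters if all columns outside it vanish. -/
theorem vnetOut_castLE {d r : ℕ} (hrd : r ≤ d) (act : ℝ → ℝ) (Ws : ℕ → Matrix (Fin d) (Fin d) ℝ)
    (hWs : ∀ ℓ (i j : Fin d), r ≤ (j : ℕ) → Ws ℓ i j = 0) (z : Fin d → ℝ) (ℓ : ℕ) (k : Fin r) :
    vnetOut d act Ws z ℓ (Fin.castLE hrd k) =
      vnetOut r act (fun ℓ => (Ws ℓ).submatrix (Fin.castLE hrd) (Fin.castLE hrd))
        (fun j => z (Fin.castLE hrd j)) ℓ k := by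
  induction ℓ generalizing k with
  | zero => rfl
  | succ ℓ ih =>
    simp only [vnetOut, mulVec, dotProduct]
    refine (Fintype.sum_of_injective (Fin.castLE hrd) (Fin.castLE_injective hrd) _ _
      (fun j hj => ?_) fun j => ?_).symm
    · rw [hWs _ _ _ (by
        by_contra! hlt
        exact hj ⟨⟨j, hlt⟩, rfl⟩), zero_mul]
    · simp [ih]

theorem WPmat_apply_eq_zero {d r T : ℕ} (u : Fin T → Fin d → ℝ) (hu : ∀ t, u t ∈ spanFirst d r)
    (w : Fin T → ℕ) (ℓ : ℕ) (i j : Fin d) (hj : r ≤ (j : ℕ)) : WPmat u w ℓ i j = 0 := by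
  rw [WPmat, Matrix.sum_apply]
  refine Finset.sum_eq_zero fun t _ => ?_
  split_ifs <;> simp [vecMulVec_apply, hu _ j hj]

theorem WPfam_apply_eq_zero {d r T : ℕ} (u : Fin T → Fin d → ℝ) (hu : ∀ t, u t ∈ spanFirst d r)
    (w : Fin T → ℕ) (n ℓ : ℕ) (i j : Fin d) (hj : r ≤ (j : ℕ)) : WPfam u w n ℓ i j = 0 := by
  have hcorr : WPcorr u w i j = 0 := by
    unfold WPcorr
    split_ifs
    · rw [vecMulVec_apply, Finset.sum_apply, Finset.sum_eq_zero, mul_zero]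
      intro t _
      split_ifs <;> simp [hu _ j hj]
    all_goals rfl
  unfold WPfam WPone
  split_ifs <;> simp [WPmat_apply_eq_zero u hu w _ i j hj, hcorr]

theorem continuous_vnetOut {d : ℕ} {act : ℝ → ℝ} (hact : Continuous act)
    (Ws : ℕ → Matrix (Fin d) (Fin d) ℝ) (ℓ : ℕ) :
    Continuous fun z => vnetOut d act Ws z ℓ := by
  induction ℓ with
  | zero => exact continuous_id
  | succ ℓ ih =>
    simp only [vnetOut]
    refine Continuous.matrix_mulVec continuous_const (continuous_pi fun k => ?_)
    split_ifs
    · fun_prop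
    · exact hact.comp ((continuous_apply k).comp ih)

theorem continuous_embed (d p : ℕ) : Continuous (embed d p) := by
  refine continuous_pi fun k => ?_
  unfold embed
  split_ifs <;> fun_prop

/-- Under emulation the function approximator is the virtual network. -/
theorem fhat_eq_vnetOut {d : ℕ}
    {forward : List (Fin (4 * d + 8) → ℝ) → List (Fin (4 * d + 8) → ℝ)} {act : ℝ → ℝ}
    (h : EmulatesWith d forward act) (hd : 0 < d) {B : ℝ} (hB : 1 ≤ B) {T L : ℕ} (hT : 0 < T)
    (hL : 0 < L) {U : Set (Fin d → ℝ)} (hU : U ⊆ eball d B) {S : ℝ}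
    (hS : max ((d : ℝ) * B ^ (4 * L) * (T : ℝ) ^ (2 * L)) (2 * (L : ℝ)) ≤ S)
    {u : Fin T → Fin d → ℝ} {w : Fin T → ℕ} (huw : ValidPrompt U T L u w) {p : ℕ}
    {x : Fin p → ℝ} (hx : x ∈ unitCube p) :
    fhat forward u w S L p x = vnetOut d act (WPfam u w 0) (embed d p x) L ⟨0, hd⟩ := by
  have := h B hB T L hT hL U hU S hS u w huw 1 one_pos (fun _ => embed d p x) (fun _ k => by
    unfold embed
    split_ifs
    · exact ⟨hx.1 _, hx.2 _⟩
    all_goals simp) 0 L hL le_rfl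
  rw [fhat, show T + 1 + L = T + 1 * L + ((0 : Fin 1) : ℕ) + 1 by simp; ring, this]
  simp [promptToken, hd]

theorem abs_sub_le_supDist {p : ℕ} {f g : (Fin p → ℝ) → ℝ} (hf : ContinuousOn f (unitCube p))
    (hg : ContinuousOn g (unitCube p)) {x : Fin p → ℝ} (hx : x ∈ unitCube p) :
    |f x - g x| ≤ supDist p f g := by
  have hbdd : BddAbove ((fun x => |f x - g x|) '' unitCube p) :=
    (isCompact_Icc.image_of_continuousOn (hf.sub hg).abs).bddAbove
  rw [Set.image_eq_range] at hbdd
  exact le_ciSup hbdd ⟨x, hx⟩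

open scoped ContDiff in
/-- A smooth bump on the line with all derivatives supported well inside `[0, 1]` and bounded. -/
theorem exists_bump_iteratedDeriv_bound (β : ℕ) : ∃ (ψ : ℝ → ℝ) (C : ℝ), ContDiff ℝ ∞ ψ ∧
    ψ (1 / 2) = 1 ∧ (∀ n t, iteratedDeriv n ψ t ≠ 0 → |t - 1 / 2| ≤ 1 / 4) ∧ 1 ≤ C ∧
    ∀ n ≤ β, ∀ t, |iteratedDeriv n ψ t| ≤ C := by
  let b : ContDiffBump (1 / 2 : ℝ) := ⟨1 / 8, 1 / 4, by norm_num, by norm_num⟩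
  have hb : ContDiff ℝ ∞ b := b.contDiff
  have hsupp : ∀ n, Function.support (iteratedDeriv n b) ⊆ Metric.closedBall (1 / 2 : ℝ) (1 / 4) := by
    intro n
    induction n with
    | zero => rw [iteratedDeriv_zero, b.support_eq]; exact Metric.ball_subset_closedBall
    | succ n ih =>
      rw [iteratedDeriv_succ]
      exact support_deriv_subset.trans (closure_minimal ih Metric.isClosed_closedBall)
  have hbound : ∀ n, ∃ C, ∀ t, ‖iteratedDeriv n b t‖ ≤ C := fun n =>
    (hb.continuous_iteratedDeriv n (by exact_mod_cast le_top)).bounded_above_of_compact_support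
      (HasCompactSupport.of_support_subset_isCompact (isCompact_closedBall _ _) (hsupp n))
  choose C hC using hbound
  refine ⟨b, 1 + ∑ n ∈ Finset.range (β + 1), |C n|, hb, ?_, fun n t ht => ?_, ?_, fun n hn t => ?_⟩
  · exact b.one_of_mem_closedBall (Metric.mem_closedBall_self (by norm_num [b]))
  · simpa [Real.dist_eq] using hsupp n ht
  · exact le_add_of_nonneg_right (Finset.sum_nonneg fun _ _ => abs_nonneg _)
  · have h1 := Finset.single_le_sum (f := fun n => |C n|) (fun _ _ => abs_nonneg _)
      (Finset.mem_range.2 (Nat.lt_succ_of_le hn))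
    have h2 := (hC n t).trans (le_abs_self _)
    rw [Real.norm_eq_abs] at h2
    linarith

/-- A combination of tensor products of derivatives of `ψ`, rescaled to the cells of the regular
grid of mesh `1 / M`. -/
noncomputable def gridSum {p M : ℕ} (ψ : ℝ → ℝ) (c : (Fin p → Fin M) → ℝ) (a : Fin p → ℕ)
    (x : Fin p → ℝ) : ℝ :=
  ∑ i, c i * ∏ j, iteratedDeriv (a j) ψ (M * x j - (i j : ℕ))

/-- The centers of the cells of the regular grid of mesh `1 / M`. -/
noncomputable def gridCenter {p M : ℕ} (k : Fin p → Fin M) : Fin p → ℝ :=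
  fun j => ((k j : ℕ) + 1 / 2) / M

theorem gridCenter_mem_unitCube {p M : ℕ} (k : Fin p → Fin M) : gridCenter k ∈ unitCube p := by
  have h : ∀ j, ((k j : ℕ) : ℝ) + 1 ≤ M := fun j => by exact_mod_cast (k j).2
  refine ⟨fun j => ?_, fun j => ?_⟩
  · simp only [Pi.zero_apply, gridCenter]; positivity
  · have := h j
    have hM : (0 : ℝ) < M := by have : (0 : ℝ) ≤ (k j : ℕ) := Nat.cast_nonneg _; linarith
    simp only [Pi.one_apply, gridCenter]
    rw [div_le_one hM]
    linarith

open scoped ContDiff in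
theorem contDiff_iteratedDeriv {ψ : ℝ → ℝ} (hψ : ContDiff ℝ ∞ ψ) (n : ℕ) :
    ContDiff ℝ ∞ (iteratedDeriv n ψ) := by
  rw [iteratedDeriv_eq_iterate]
  exact hψ.iterate_deriv n

open scoped ContDiff in
theorem contDiff_gridSum {p M : ℕ} {ψ : ℝ → ℝ} (hψ : ContDiff ℝ ∞ ψ)
    (c : (Fin p → Fin M) → ℝ) (a : Fin p → ℕ) : ContDiff ℝ ∞ (gridSum ψ c a) := by
  unfold gridSum
  refine ContDiff.sum fun i _ => contDiff_const.mul (contDiff_prod fun j _ => ?_)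
  exact (contDiff_iteratedDeriv hψ _).comp
    ((contDiff_const.mul (contDiff_apply ℝ ℝ j)).sub contDiff_const)

theorem uniqueDiffOn_unitCube (p : ℕ) : UniqueDiffOn ℝ (unitCube p) := by
  have : unitCube p = Set.univ.pi fun _ => Set.Icc (0 : ℝ) 1 := (Set.pi_univ_Icc _ _).symm
  rw [this]
  exact UniqueDiffOn.univ_pi fun _ => uniqueDiffOn_Icc one_pos

open scoped ContDiff in
theorem pderivW_gridSum {p M : ℕ} {ψ : ℝ → ℝ} (hψ : ContDiff ℝ ∞ ψ)
    (c : (Fin p → Fin M) → ℝ) (a : Fin p → ℕ) (j : Fin p) {x : Fin p → ℝ}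
    (hx : x ∈ unitCube p) :
    pderivW p j (gridSum ψ c a) x
      = gridSum ψ (fun i => M * c i) (Function.update a j (a j + 1)) x := by
  have hdiff : DifferentiableAt ℝ (gridSum ψ c a) x :=
    (contDiff_gridSum hψ c a).differentiable (by simp) x
  rw [pderivW, hdiff.fderivWithin (uniqueDiffOn_unitCube p x hx), ← hdiff.lineDeriv_eq_fderiv]
  refine HasDerivAt.deriv ?_
  unfold gridSum
  refine HasDerivAt.fun_sum fun i _ => ?_
  have hsplit : ∀ (b : Fin p → ℕ) (y : Fin p → ℝ),
      ∏ k, iteratedDeriv (b k) ψ (M * y k - (i k : ℕ))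
        = iteratedDeriv (b j) ψ (M * y j - (i j : ℕ)) *
          ∏ k ∈ Finset.univ.erase j, iteratedDeriv (b k) ψ (M * y k - (i k : ℕ)) := fun b y =>
    (Finset.mul_prod_erase _ _ (Finset.mem_univ j)).symm
  have hinner : HasDerivAt (fun t : ℝ => (M : ℝ) * (x j + t) - (i j : ℕ)) M 0 := by
    simpa using (((hasDerivAt_id' (0 : ℝ)).const_add (x j)).const_mul (M : ℝ)).sub_const
      ((i j : ℕ) : ℝ)
  have houter : HasDerivAt (iteratedDeriv (a j) ψ)
      (iteratedDeriv (a j + 1) ψ (M * x j - (i j : ℕ))) ((M : ℝ) * (x j + 0) - (i j : ℕ)) := by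
    rw [add_zero, iteratedDeriv_succ]
    exact ((contDiff_iteratedDeriv hψ _).differentiable (by simp) _).hasDerivAt
  have hcomp := ((houter.comp (0 : ℝ) hinner).mul_const
    (∏ k ∈ Finset.univ.erase j, iteratedDeriv (a k) ψ (M * x k - (i k : ℕ)))).const_mul (c i)
  have hconst : ∀ y : Fin p → ℝ, (∀ k ≠ j, y k = x k) → ∀ b : Fin p → ℕ, (∀ k ≠ j, b k = a k) →
      ∏ k ∈ Finset.univ.erase j, iteratedDeriv (b k) ψ (M * y k - (i k : ℕ))
        = ∏ k ∈ Finset.univ.erase j, iteratedDeriv (a k) ψ (M * x k - (i k : ℕ)) :=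
    fun y hy b hb => Finset.prod_congr rfl fun k hk => by
      rw [hy k (Finset.ne_of_mem_erase hk), hb k (Finset.ne_of_mem_erase hk)]
  refine (hcomp.congr_deriv ?_).congr_of_eventuallyEq (Filter.Eventually.of_forall fun t => ?_)
  · rw [hsplit, hconst x (fun _ _ => rfl) (Function.update a j (a j + 1)) fun k hk => by
      simp [hk]]
    simp only [Function.update_self]
    ring
  · simp only
    rw [hsplit, hconst _ (fun k hk => by simp [hk]) _ fun _ _ => rfl]
    simp

theorem pderivList_congr {p : ℕ} (ls : List (Fin p)) {f g : (Fin p → ℝ) → ℝ}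
    (h : Set.EqOn f g (unitCube p)) :
    Set.EqOn (pderivList p ls f) (pderivList p ls g) (unitCube p) := by
  induction ls generalizing f g with
  | nil => exact h
  | cons j ls ih =>
    refine ih fun x hx => ?_
    rw [pderivW, pderivW, fderivWithin_congr h (h hx)]

theorem abs_gridSum_le {p M : ℕ} {ψ : ℝ → ℝ} {β : ℕ} {C : ℝ}
    (hsupp : ∀ n t, iteratedDeriv n ψ t ≠ 0 → |t - 1 / 2| ≤ 1 / 4) (hC : 1 ≤ C)
    (hbd : ∀ n ≤ β, ∀ t, |iteratedDeriv n ψ t| ≤ C) {H : ℝ} (hH : 0 ≤ H)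
    {c : (Fin p → Fin M) → ℝ} (hc : ∀ i, |c i| ≤ H) {a : Fin p → ℕ} (ha : ∀ j, a j ≤ β)
    (x : Fin p → ℝ) : |gridSum ψ c a x| ≤ H * C ^ p := by
  have hrow : ∀ j, ∑ i : Fin M, |iteratedDeriv (a j) ψ (M * x j - (i : ℕ))| ≤ C := by
    intro j
    by_cases h : ∃ i : Fin M, iteratedDeriv (a j) ψ (M * x j - (i : ℕ)) ≠ 0
    · obtain ⟨i, hi⟩ := h
      rw [Finset.sum_eq_single i]
      · exact hbd _ (ha j) _
      · intro k _ hk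
        rw [abs_eq_zero]
        by_contra hk0
        have h1 := abs_le.1 (hsupp _ _ hi)
        have h2 := abs_le.1 (hsupp _ _ hk0)
        have h3 : ((k : ℕ) : ℝ) < (i : ℕ) + 1 := by linarith
        have h4 : ((i : ℕ) : ℝ) < (k : ℕ) + 1 := by linarith
        norm_cast at h3 h4
        exact hk (Fin.ext (by omega))
      · simp
    · push Not at h
      simp only [h, abs_zero, Finset.sum_const_zero]
      linarith
  calc |gridSum ψ c a x|
      ≤ ∑ i, |c i * ∏ j, iteratedDeriv (a j) ψ (M * x j - (i j : ℕ))| :=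
        Finset.abs_sum_le_sum_abs _ _
    _ ≤ ∑ i : Fin p → Fin M, H * ∏ j, |iteratedDeriv (a j) ψ (M * x j - (i j : ℕ))| := by
        refine Finset.sum_le_sum fun i _ => ?_
        rw [abs_mul, Finset.abs_prod]
        exact mul_le_mul_of_nonneg_right (hc i) (Finset.prod_nonneg fun _ _ => abs_nonneg _)
    _ = H * ∏ j, ∑ i : Fin M, |iteratedDeriv (a j) ψ (M * x j - (i : ℕ))| := by
        rw [Fintype.prod_sum, Finset.mul_sum]
    _ ≤ H * C ^ p := by
        refine mul_le_mul_of_nonneg_left ?_ hH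
        calc _ ≤ ∏ _j : Fin p, C := Finset.prod_le_prod
              (fun _ _ => Finset.sum_nonneg fun _ _ => abs_nonneg _) fun j _ => hrow j
          _ = C ^ p := by simp

open scoped ContDiff in
theorem abs_pderivList_gridSum_le {p M : ℕ} {ψ : ℝ → ℝ} {β : ℕ} {C : ℝ} (hψ : ContDiff ℝ ∞ ψ)
    (hsupp : ∀ n t, iteratedDeriv n ψ t ≠ 0 → |t - 1 / 2| ≤ 1 / 4) (hC : 1 ≤ C)
    (hbd : ∀ n ≤ β, ∀ t, |iteratedDeriv n ψ t| ≤ C) (ls : List (Fin p)) {H : ℝ} (hH : 0 ≤ H)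
    {c : (Fin p → Fin M) → ℝ} (hc : ∀ i, |c i| ≤ H) {a : Fin p → ℕ}
    (ha : ∀ j, a j + ls.length ≤ β) {x : Fin p → ℝ} (hx : x ∈ unitCube p) :
    |pderivList p ls (gridSum ψ c a) x| ≤ H * M ^ ls.length * C ^ p := by
  induction ls generalizing H c a with
  | nil => simpa [pderivList] using abs_gridSum_le hsupp hC hbd hH hc (by simpa using ha) x
  | cons j ls ih =>
    rw [pderivList, pderivList_congr ls (fun y hy => pderivW_gridSum hψ c a j hy) hx]
    refine (ih (H := M * H) (by positivity) (fun i => ?_) fun k => ?_).trans_eq ?_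
    · rw [abs_mul, Nat.abs_cast]
      exact mul_le_mul_of_nonneg_left (hc i) (Nat.cast_nonneg _)
    · have := ha k
      rw [List.length_cons] at this
      rcases eq_or_ne k j with rfl | hk
      · rw [Function.update_self]; omega
      · rw [Function.update_of_ne hk]; omega
    · rw [List.length_cons]; ring

theorem gridSum_gridCenter {p M : ℕ} {ψ : ℝ → ℝ} (hone : ψ (1 / 2) = 1)
    (hsupp : ∀ n t, iteratedDeriv n ψ t ≠ 0 → |t - 1 / 2| ≤ 1 / 4)
    (c : (Fin p → Fin M) → ℝ) (k : Fin p → Fin M) :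
    gridSum ψ c (fun _ => 0) (gridCenter k) = c k := by
  have harg : ∀ (i : Fin p → Fin M) j, (M : ℝ) * gridCenter k j - (i j : ℕ)
      = (k j : ℕ) - (i j : ℕ) + 1 / 2 := by
    intro i j
    have : (M : ℝ) ≠ 0 := by
      have := (k j).pos
      positivity
    rw [gridCenter]
    field_simp
    ring
  unfold gridSum
  rw [Finset.sum_eq_single k]
  · rw [Finset.prod_eq_one, mul_one]
    intro j _
    rw [harg, sub_self, zero_add, iteratedDeriv_zero, hone]
  · intro i _ hik
    obtain ⟨j, hj⟩ := Function.ne_iff.1 hik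
    rw [Finset.prod_eq_zero (Finset.mem_univ j), mul_zero]
    by_contra h
    have h1 := abs_le.1 (hsupp _ _ h)
    rw [harg] at h1
    have h3 : ((k j : ℕ) : ℝ) < (i j : ℕ) + 1 := by linarith
    have h4 : ((i j : ℕ) : ℝ) < (k j : ℕ) + 1 := by linarith
    norm_cast at h3 h4
    exact hj (Fin.ext (by omega))
  · simp

/-- The class `Hclass p β` realizes every sign pattern on the grid centers, with values of size
proportional to `M ^ (-β)`. -/
theorem exists_Hclass_gridCenter (p β : ℕ) : ∃ h : ℝ, 0 < h ∧ ∀ M : ℕ, 0 < M →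
    ∀ s : (Fin p → Fin M) → Bool, ∃ f ∈ Hclass p β,
      ∀ k, f (gridCenter k) = (if s k then 1 else -1) * (h / M ^ β) := by
  obtain ⟨ψ, C, hψ, hone, hsupp, hC, hbd⟩ := exists_bump_iteratedDeriv_bound β
  refine ⟨(C ^ p)⁻¹, by positivity, fun M hM s => ?_⟩
  have hM1 : (1 : ℝ) ≤ M := by exact_mod_cast hM
  refine ⟨gridSum ψ (fun k => (if s k then 1 else -1) * ((C ^ p)⁻¹ / M ^ β)) fun _ => 0,
    ⟨((contDiff_gridSum hψ _ _).of_le (by exact_mod_cast le_top)).contDiffOn,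
      fun ls hls x hx => ?_⟩, fun k => gridSum_gridCenter hone hsupp _ k⟩
  refine (abs_pderivList_gridSum_le hψ hsupp hC hbd ls (H := (C ^ p)⁻¹ / M ^ β) (by positivity)
    (fun k => ?_) (fun _ => by simpa using hls) hx).trans ?_
  · have : 0 ≤ (C ^ p)⁻¹ / (M : ℝ) ^ β := by positivity
    split_ifs <;> simp [abs_of_nonneg this]
  · have hpow : (M : ℝ) ^ ls.length ≤ M ^ β := pow_le_pow_right₀ hM1 hls
    have hCp : C ^ p ≠ 0 := by positivity
    calc (C ^ p)⁻¹ / M ^ β * M ^ ls.length * C ^ p = M ^ ls.length / M ^ β := by field_simp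
      _ ≤ 1 := div_le_one_of_le₀ hpow (by positivity)

/-- A grid with a number of points of order `G ^ 2 * log G` on which sign patterns outnumber those
of networks with width times depth equal to `G`. -/
theorem exists_pow_grid_size (p : ℕ) (hp : 0 < p) : ∃ c : ℕ, 0 < c ∧ ∀ G : ℕ, 2 ≤ G →
    ∃ M : ℕ, 0 < M ∧ M ^ p ≤ c * (G ^ 2 * Nat.log 2 G) ∧
      (2 * (M ^ p * G) + 1) ^ (G ^ 2) < 2 ^ M ^ p := by
  classical
  refine ⟨2 ^ p * 2 ^ (p + 10), by positivity, fun G hG => ?_⟩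
  set e := p + 10 with he
  set g := Nat.log 2 G with hg
  have hg1 : 1 ≤ g := Nat.log_pos one_lt_two hG
  have hgG : g ≤ G := Nat.log_le_self 2 G
  have hG2 : G ≤ 2 ^ (2 * g) :=
    (Nat.lt_pow_succ_log_self one_lt_two G).le.trans (Nat.pow_le_pow_right two_pos (by omega))
  have hN : 0 < 2 ^ e * (G ^ 2 * g) := by positivity
  have hex : ∃ M, 2 ^ e * (G ^ 2 * g) ≤ M ^ p := ⟨_, Nat.le_self_pow hp.ne' _⟩
  obtain ⟨M, hM, hmin⟩ : ∃ M, 2 ^ e * (G ^ 2 * g) ≤ M ^ p ∧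
      ∀ m < M, m ^ p < 2 ^ e * (G ^ 2 * g) :=
    ⟨Nat.find hex, Nat.find_spec hex, fun m hm => not_le.1 (Nat.find_min hex hm)⟩
  have hM0 : 0 < M := by
    by_contra h0
    obtain rfl : M = 0 := by omega
    rw [zero_pow hp.ne'] at hM
    omega
  have hMle : M ^ p ≤ 2 ^ p * (2 ^ e * (G ^ 2 * g)) := by
    rcases Nat.lt_or_ge M 2 with h | h
    · obtain rfl : M = 1 := by omega
      rw [one_pow]
      exact Nat.mul_pos (by positivity) hN
    · calc M ^ p ≤ (2 * (M - 1)) ^ p := Nat.pow_le_pow_left (by omega) p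
        _ = 2 ^ p * (M - 1) ^ p := mul_pow _ _ _
        _ ≤ _ := Nat.mul_le_mul_left _ (hmin _ (by omega)).le
  refine ⟨M, hM0, by rw [mul_assoc]; exact hMle, ?_⟩
  have hbase : 2 * (M ^ p * G) + 1 ≤ 2 ^ (2 + p + e + 8 * g) := by
    have hpos : 0 < M ^ p * G := by positivity
    calc 2 * (M ^ p * G) + 1 ≤ 2 ^ 2 * (M ^ p * G) := by omega
      _ ≤ 2 ^ 2 * ((2 ^ p * (2 ^ e * (G ^ 2 * G))) * G) := by
          gcongr
          exact hMle.trans (by gcongr)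
      _ = 2 ^ (2 + p + e) * G ^ 4 := by ring
      _ ≤ 2 ^ (2 + p + e) * (2 ^ (2 * g)) ^ 4 := by gcongr
      _ = _ := by rw [← pow_mul, ← pow_add]; ring_nf
  calc (2 * (M ^ p * G) + 1) ^ (G ^ 2) ≤ (2 ^ (2 + p + e + 8 * g)) ^ (G ^ 2) := by gcongr
    _ = 2 ^ ((2 + p + e + 8 * g) * G ^ 2) := by rw [pow_mul]
    _ < 2 ^ M ^ p := by
      refine Nat.pow_lt_pow_right one_lt_two (lt_of_lt_of_le ?_ hM)
      have hpe : 10 + p + e < 2 ^ e := by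
        have := Nat.lt_two_pow_self (n := p)
        rw [he, pow_add]
        omega
      have : 2 + p + e + 8 * g < 2 ^ e * g := by nlinarith
      calc _ < 2 ^ e * g * G ^ 2 := Nat.mul_lt_mul_of_pos_right this (by positivity)
        _ = _ := by ring

theorem mul_rpow_neg_div_le_div_pow {p β c G M : ℕ} (hp : 0 < p) (hG : 2 ≤ G) (hM : 0 < M)
    (h : M ^ p ≤ c * (G ^ 2 * Nat.log 2 G)) :
    (2 * c : ℝ) ^ (-(β : ℝ) / p) * ((G : ℝ) ^ 2 * Real.log G) ^ (-(β : ℝ) / p) ≤ 1 / M ^ β := by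
  have hlog : (Nat.log 2 G : ℝ) ≤ 2 * Real.log G := by
    have h1 := Real.natLog_le_logb G 2
    rw [Real.logb, Nat.cast_ofNat, le_div_iff₀ (Real.log_pos one_lt_two)] at h1
    have h2 := Real.log_two_gt_d9
    have h3 : (0 : ℝ) ≤ Nat.log 2 G := Nat.cast_nonneg _
    nlinarith
  have hlogpos : 0 ≤ Real.log G := Real.log_natCast_nonneg G
  have hle : (M : ℝ) ^ p ≤ 2 * c * ((G : ℝ) ^ 2 * Real.log G) := by
    calc (M : ℝ) ^ p ≤ c * ((G : ℝ) ^ 2 * Nat.log 2 G) := by exact_mod_cast h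
      _ ≤ c * ((G : ℝ) ^ 2 * (2 * Real.log G)) := by gcongr
      _ = _ := by ring
  have hM' : (0 : ℝ) < M := by exact_mod_cast hM
  rw [← Real.mul_rpow (by positivity) (by positivity)]
  refine (Real.rpow_le_rpow_of_nonpos (by positivity) hle
    (div_nonpos_of_nonpos_of_nonneg (by simp) (by positivity))).trans_eq ?_
  rw [← Real.rpow_natCast, ← Real.rpow_mul hM'.le,
    mul_div_cancel₀ _ (by positivity : (p : ℝ) ≠ 0), Real.rpow_neg hM'.le, Real.rpow_natCast,
    one_div]

/-- Lower bound on the prompt approximation error: there is `C' > 0`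
depending only on `β, p` such that for `p ≤ r ≤ d` and `rL ≥ 2`,
`sup_f inf_{S ≥ max(d·B^{4L}·T^{2L}, 2L), H^P ∈ Q_{U_{d,r}(B)}(T,L,S)} ‖f̂ − f‖_∞
  ≥ C'·(r²L²·log(rL))^{−β/p}`. -/
theorem statement_15 :
    ∀ p β : ℕ, 0 < p → 0 < β →
    ∃ C' : ℝ, 0 < C' ∧
      ∀ B : ℝ, 1 ≤ B → ∀ d : ℕ, p + 1 ≤ d →
      ∀ Θ : List (TFLayer (4 * d + 8)), EmulatesWith d (tfForward Θ) relu →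
      ∀ T L r : ℕ, 0 < T → 0 < L → p ≤ r → r ≤ d → 2 ≤ r * L →
      ∀ δ : ℝ, 0 < δ →
        ∃ f ∈ Hclass p β,
          ∀ S : ℝ, max ((d : ℝ) * B ^ (4 * L) * (T : ℝ) ^ (2 * L)) (2 * (L : ℝ)) ≤ S →
          ∀ (T' : ℕ) (u : Fin T' → Fin d → ℝ) (w : Fin T' → ℕ),
            1 ≤ T' → T' ≤ T → ValidPrompt (spanFirst d r ∩ eball d B) T' L u w →
            C' * (((r : ℝ) ^ 2 * (L : ℝ) ^ 2 * Real.log ((r : ℝ) * (L : ℝ)))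
                ^ (-(β : ℝ) / (p : ℝ))) - δ
              ≤ supDist p f (fhat (tfForward Θ) u w S L p) := by
  intro p β hp _
  obtain ⟨h, hh, hHclass⟩ := exists_Hclass_gridCenter p β
  obtain ⟨c, hc, hgrid⟩ := exists_pow_grid_size p hp
  refine ⟨h * (2 * c : ℝ) ^ (-(β : ℝ) / p), by positivity, ?_⟩
  intro B hB d hd Θ hΘ T L r hT hL hpr hrd hrL δ hδ
  obtain ⟨M, hM, hMle, hMlt⟩ := hgrid (r * L) hrL
  have hrate : h * (2 * c : ℝ) ^ (-(β : ℝ) / p) *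
      ((r : ℝ) ^ 2 * (L : ℝ) ^ 2 * Real.log ((r : ℝ) * (L : ℝ))) ^ (-(β : ℝ) / (p : ℝ))
        ≤ h / M ^ β := by
    have := mul_rpow_neg_div_le_div_pow (β := β) hp hrL hM hMle
    rw [Nat.cast_mul, mul_pow] at this
    calc _ = h * ((2 * c : ℝ) ^ (-(β : ℝ) / p) *
          ((r : ℝ) ^ 2 * (L : ℝ) ^ 2 * Real.log ((r : ℝ) * (L : ℝ))) ^ (-(β : ℝ) / (p : ℝ))) := by
            ring
      _ ≤ h * (1 / M ^ β) := by gcongr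
      _ = _ := by ring
  by_contra! hcon
  have hr : 0 < r := hp.trans_le hpr
  have hd0 : 0 < d := hr.trans_le hrd
  have hnet : ∀ s : (Fin p → Fin M) → Bool, ∃ Ws : ℕ → Matrix (Fin r) (Fin r) ℝ, ∀ k,
      0 < vnetOut r relu Ws (fun j => embed d p (gridCenter k) (Fin.castLE hrd j)) L ⟨0, hr⟩ ↔
        s k = true := by
    intro s
    obtain ⟨f, hf, hfval⟩ := hHclass M hM s
    obtain ⟨S, hS, T', u, w, hT', hT'T, huw, hlt⟩ := hcon f hf
    have hS' : max ((d : ℝ) * B ^ (4 * L) * (T' : ℝ) ^ (2 * L)) (2 * (L : ℝ)) ≤ S := by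
      refine le_trans (max_le_max_right _ ?_) hS
      gcongr
    have hfhat : ∀ x ∈ unitCube p, fhat (tfForward Θ) u w S L p x
        = vnetOut d relu (WPfam u w 0) (embed d p x) L ⟨0, hd0⟩ := fun x hx =>
      fhat_eq_vnetOut hΘ hd0 hB hT' hL Set.inter_subset_right hS' huw hx
    have hcont : ContinuousOn (fhat (tfForward Θ) u w S L p) (unitCube p) := by
      have hrelu : Continuous relu := continuous_id.max continuous_const
      exact ((continuous_apply (⟨0, hd0⟩ : Fin d)).comp ((continuous_vnetOut hrelu
        (WPfam u w 0) L).comp (continuous_embed d p))).continuousOn.congr hfhat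
    refine ⟨fun ℓ => (WPfam u w 0 ℓ).submatrix (Fin.castLE hrd) (Fin.castLE hrd), fun k => ?_⟩
    rw [← vnetOut_castLE hrd relu _
      (fun ℓ i j hj => WPfam_apply_eq_zero u (fun t => (huw.1 t).1) w 0 ℓ i j hj)
      (embed d p (gridCenter k))]
    have hk := gridCenter_mem_unitCube k
    have hclose := (abs_sub_le_supDist hf.1.continuousOn hcont hk).trans_lt hlt
    rw [hfhat _ hk, hfval, abs_lt] at hclose
    change 0 < vnetOut d relu (WPfam u w 0) (embed d p (gridCenter k)) L ⟨0, hd0⟩ ↔ _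
    cases hsk : s k
    · simp only [hsk, Bool.false_eq_true, if_false, iff_false, not_lt] at hclose ⊢
      linarith [hclose.1]
    · simp only [hsk, if_true, iff_true] at hclose ⊢
      linarith [hclose.2]
  choose Ws hWs using hnet
  have hcount := two_pow_card_le_of_vnetOut_pos_iff hL Ws _ ⟨0, hr⟩ hWs
  rw [Fintype.card_fun, Fintype.card_fin, Fintype.card_fin, ← pow_mul, mul_assoc (M ^ p),
    show L * (r * r) * L = (r * L) ^ 2 by ring] at hcount
  exact absurd hcount (not_le.2 hMlt)
end

section
/- Fix B≥1, p,d,β∈ℕ+ with p ≤ d−1, and a subset J⊆[d]. Let U(B):=span{e_j : j∈J}∩B_d(B) and Ũ(B):=span{e_j : j∈[d]∖J}∩B_d(B). Let Θ be any transformer parameters with the emulation property. Then for all T,T̃,L,L̃∈ℕ+: sup_{f∈C_u^β([0,1]^p)} inf over S>0, S̃>0, S' ≥ max(d·B^{4(L+L̃)}·(T+T̃)^{2(L+L̃)}, 2(L+L̃)+1), H^P∈P_{U(B)}(T,L,S), and H̃^P∈P_{Ũ(B)}(T̃,L̃,S̃), of ‖f̂_{Θ, H̃^P⊕'H^P, L̃+L,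 p} − f‖_{L^∞([0,1]^p)} ≥ 1. -/
open scoped BigOperators
open Matrix

open PromptTF Matrix

namespace PromptTF

lemma abs_pderivList_const_le_one {p : ℕ} (ls : List (Fin p)) {c : ℝ} (hc : |c| ≤ 1)
    (x : Fin p → ℝ) : |pderivList p ls (fun _ => c) x| ≤ 1 := by
  induction ls generalizing c with
  | nil => exact hc
  | cons i is ih =>
    have h : pderivW p i (fun _ => c) = fun _ => 0 := by
      funext y
      simp [pderivW]
    rw [pderivList, h]
    exact ih (by simp)

lemma one_mem_Hclass (p β : ℕ) : (fun _ => (1 : ℝ)) ∈ Hclass p β :=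
  ⟨contDiffOn_const, fun ls _ x _ => abs_pderivList_const_le_one ls (by simp) x⟩

lemma WPmat_eq_zero_of_row {d T : ℕ} {u : Fin T → Fin d → ℝ} {w : Fin T → ℕ} {ℓ : ℕ}
    {k : Fin d} (h : ∀ j, w j = 2 * ℓ - 1 → u j k = 0) (m : Fin d) :
    WPmat u w ℓ k m = 0 := by
  rw [WPmat, Matrix.sum_apply]
  refine Finset.sum_eq_zero fun j _ => ?_
  split_ifs with h₁ h₂
  · rw [vecMulVec_apply, h j h₂.1, zero_mul]
  · rfl
  · rfl

lemma WPmat_eq_zero_of_col {d T : ℕ} {u : Fin T → Fin d → ℝ} {w : Fin T → ℕ} {ℓ : ℕ}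
    {m : Fin d} (h : ∀ j, w j = 2 * ℓ → u j m = 0) (k : Fin d) :
    WPmat u w ℓ k m = 0 := by
  rw [WPmat, Matrix.sum_apply]
  refine Finset.sum_eq_zero fun j _ => ?_
  split_ifs with h₁ h₂
  · rw [vecMulVec_apply, h _ h₂.2, mul_zero]
  · rfl
  · rfl

lemma WPcorr_eq_zero {d T : ℕ} (u : Fin T → Fin d → ℝ) {w : Fin T → ℕ} (hT : 0 < T)
    (h : w ⟨T - 1, by omega⟩ ≠ 1) : WPcorr u w = 0 := by
  rw [WPcorr, dif_pos hT, if_neg h]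

lemma WPfam_eq_WPmat {d T : ℕ} (u : Fin T → Fin d → ℝ) {w : Fin T → ℕ} (hT : 0 < T)
    (h : w ⟨T - 1, by omega⟩ ≠ 1) (i ℓ : ℕ) : WPfam u w i ℓ = WPmat u w ℓ := by
  by_cases hℓ : ℓ = 1
  · simp [WPfam, WPone, WPcorr_eq_zero u hT h, hℓ]
  · simp [WPfam, hℓ]

/-- If the rows of one weight matrix and the columns of the next one have disjoint supports,
the virtual network vanishes from that layer on. -/
lemma vnetOut_eq_zero {d : ℕ} {Ws : ℕ → Matrix (Fin d) (Fin d) ℝ} {J : Set (Fin d)} {n : ℕ}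
    (hn : 0 < n) (hrow : ∀ k ∈ J, ∀ m, Ws n k m = 0) (hcol : ∀ m ∉ J, ∀ k, Ws (n + 1) k m = 0)
    (z : Fin d → ℝ) {ℓ : ℕ} (hℓ : n + 1 ≤ ℓ) : vnetOut d relu Ws z ℓ = 0 := by
  induction ℓ, hℓ using Nat.le_induction with
  | base =>
    obtain ⟨n, rfl⟩ : ∃ a, n = a + 1 := ⟨n - 1, by omega⟩
    funext k
    rw [vnetOut, Matrix.mulVec, dotProduct]
    refine Finset.sum_eq_zero fun m _ => ?_
    by_cases hm : m ∈ J
    · have h0 : vnetOut d relu Ws z (n + 1) m = 0 := by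
        rw [vnetOut, Matrix.mulVec, dotProduct]
        exact Finset.sum_eq_zero fun j _ => by rw [hrow m hm, zero_mul]
      simp [h0, relu]
    · rw [hcol m hm, zero_mul]
  | succ ℓ hℓ ih =>
    funext k
    rw [vnetOut, ih]
    simp [Matrix.mulVec, dotProduct, relu]

lemma EmulatesWith.fhat_eq {d : ℕ}
    {forward : List (Fin (4 * d + 8) → ℝ) → List (Fin (4 * d + 8) → ℝ)}
    (h : EmulatesWith d forward relu) (hd : 0 < d) {B : ℝ} (hB : 1 ≤ B) {T L : ℕ}
    (hT : 0 < T) (hL : 0 < L) {S : ℝ}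
    (hS : max ((d : ℝ) * B ^ (4 * L) * (T : ℝ) ^ (2 * L)) (2 * (L : ℝ)) ≤ S)
    {u : Fin T → Fin d → ℝ} {w : Fin T → ℕ} (hv : ValidPrompt (eball d B) T L u w)
    {p : ℕ} {x : Fin p → ℝ} (hx : x ∈ unitCube p) :
    fhat forward u w S L p x = vnetOut d relu (WPfam u w 0) (embed d p x) L ⟨0, hd⟩ := by
  have hz : ∀ (_ : Fin 1) (k : Fin d), embed d p x k ∈ Set.Icc (0 : ℝ) 1 := by
    intro _ k
    unfold embed
    split_ifs with h₁
    · exact ⟨hx.1 ⟨k, h₁⟩, hx.2 ⟨k, h₁⟩⟩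
    · simp
    · simp
  have key := h B hB T L hT hL _ subset_rfl S hS u w hv 1 one_pos (fun _ => embed d p x) hz
    0 L hL le_rfl
  have hpos : T + 1 * L + ((0 : Fin 1) : ℕ) + 1 = T + 1 + L := by
    simp only [Fin.val_zero]
    omega
  rw [hpos] at key
  rw [fhat, key]
  simp [promptToken, hd]

end PromptTF

/-- An irrelevant chain-of-thought prefix (with word embeddings supported on
the coordinates outside `J`, while the relevant prompt is supported on `J`) forces a constant
lower bound on the approximation error:
`sup_f inf ‖f̂_{Θ, H̃^P ⊕' H^P, L̃+L, p} − f‖_∞ ≥ 1`. -/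
theorem statement_17 (B : ℝ) (hB : 1 ≤ B) (p d β : ℕ) (hp : 0 < p) (hβ : 0 < β)
    (hpd : p + 1 ≤ d) (J : Set (Fin d))
    (Θ : List (TFLayer (4 * d + 8))) (hΘ : EmulatesWith d (tfForward Θ) relu)
    (T Tt L Lt : ℕ) (hT : 0 < T) (hTt : 0 < Tt) (hL : 0 < L) (hLt : 0 < Lt) :
    ∀ δ : ℝ, 0 < δ →
      ∃ f ∈ Hclass p β,
        ∀ S St : ℝ, 0 < S → 0 < St →
        ∀ S' : ℝ,
          max ((d : ℝ) * B ^ (4 * (L + Lt)) * ((T : ℝ) + (Tt : ℝ)) ^ (2 * (L + Lt)))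
            (2 * ((L : ℝ) + (Lt : ℝ)) + 1) ≤ S' →
        ∀ (ut : Fin Tt → Fin d → ℝ) (wt : Fin Tt → ℕ),
          ValidPrompt ({v : Fin d → ℝ | ∀ k : Fin d, k ∈ J → v k = 0} ∩ eball d B)
            Tt Lt ut wt →
        ∀ (u : Fin T → Fin d → ℝ) (w : Fin T → ℕ),
          ValidPrompt ({v : Fin d → ℝ | ∀ k : Fin d, k ∉ J → v k = 0} ∩ eball d B)
            T L u w →
          1 - δ ≤ supDist p f
            (fhat (tfForward Θ)
              (fun j : Fin (Tt + T) =>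
                if h : (j : ℕ) < Tt then ut ⟨j, h⟩
                else u ⟨(j : ℕ) - Tt, by have := j.isLt; omega⟩)
              (fun j : Fin (Tt + T) =>
                if h : (j : ℕ) < Tt then wt ⟨j, h⟩
                else 2 * Lt + w ⟨(j : ℕ) - Tt, by have := j.isLt; omega⟩)
              S' (Lt + L) p) := by
  intro δ hδ
  refine ⟨fun _ => 1, one_mem_Hclass p β, ?_⟩
  intro S St _ _ S' hS' ut wt hvt u w hv
  set uu : Fin (Tt + T) → Fin d → ℝ := fun j =>
    if h : (j : ℕ) < Tt then ut ⟨j, h⟩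
    else u ⟨(j : ℕ) - Tt, by have := j.isLt; omega⟩ with huu
  set ww : Fin (Tt + T) → ℕ := fun j =>
    if h : (j : ℕ) < Tt then wt ⟨j, h⟩
    else 2 * Lt + w ⟨(j : ℕ) - Tt, by have := j.isLt; omega⟩ with hww
  have hvalid : ValidPrompt (eball d B) (Tt + T) (Lt + L) uu ww := by
    refine ⟨fun j => ?_, fun j => ?_⟩
    · simp only [huu]
      split_ifs
      · exact (hvt.1 _).2
      · exact (hv.1 _).2
    · simp only [hww]
      split_ifs with h
      · have := hvt.2 ⟨j, h⟩
        omega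
      · have := hv.2 ⟨(j : ℕ) - Tt, by have := j.isLt; omega⟩
        omega
  have hlast : ww ⟨Tt + T - 1, by omega⟩ ≠ 1 := by
    have h : ¬ Tt + T - 1 < Tt := by omega
    simp only [hww, h, dite_false]
    omega
  have hrow : ∀ k ∈ J, ∀ m, WPfam uu ww 0 Lt k m = 0 := by
    intro k hk m
    rw [WPfam_eq_WPmat uu (by omega) hlast]
    refine WPmat_eq_zero_of_row (fun j hj => ?_) m
    simp only [huu]
    simp only [hww] at hj
    split_ifs at hj ⊢ with h
    · exact (hvt.1 _).1 k hk
    · omega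
  have hcol : ∀ m ∉ J, ∀ k, WPfam uu ww 0 (Lt + 1) k m = 0 := by
    intro m hm k
    rw [WPfam_eq_WPmat uu (by omega) hlast]
    refine WPmat_eq_zero_of_col (fun j hj => ?_) k
    simp only [huu]
    simp only [hww] at hj
    split_ifs at hj ⊢ with h
    · have := hvt.2 ⟨j, h⟩
      omega
    · exact (hv.1 _).1 m hm
  have hS : max ((d : ℝ) * B ^ (4 * (Lt + L)) * ((Tt + T : ℕ) : ℝ) ^ (2 * (Lt + L)))
      (2 * ((Lt + L : ℕ) : ℝ)) ≤ S' := by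
    refine le_trans (max_le_max (le_of_eq ?_) ?_) hS'
    · push_cast
      rw [add_comm Lt, add_comm (Tt : ℝ)]
    · push_cast
      linarith
  have hzero : ∀ x : unitCube p,
      |1 - fhat (tfForward Θ) uu ww S' (Lt + L) p x.1| = 1 := by
    intro x
    rw [hΘ.fhat_eq (by omega) hB (by omega) (by omega) hS hvalid x.2,
      vnetOut_eq_zero hLt hrow hcol _ (by omega)]
    simp
  have : Nonempty (unitCube p) := ⟨⟨0, le_rfl, zero_le_one⟩⟩
  rw [supDist]
  simp only [hzero, ciSup_const]
  linarith
end

section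
/- Let Θ be any transformer parameters with the emulation property. Fix B≥1, d∈ℕ+, p,r∈ℕ+ with p ≤ r ≤ d and p ≤ d−1, T,L∈ℕ+, and S ≥ max(d·B^{4L}·T^{2L}, 2L). Then for every prompt H^P∈Q_{U_{d,r}(B)}(T,L,S) there exists a network φ̄∈N(r,p,L) such that f̂_{Θ,H^P,L,p}(x) = φ̄(x) for all x∈[0,1]^p; that is, every function realized by prompting with embeddings in U_{d,r}(B) agrees on [0,1]^p with a ReLU network of width r and depth L. -/
open scoped BigOperators
open Matrix

open PromptTF Matrix

namespace PromptTF

theorem sum_castLE_of_eq_zero {r d : ℕ} (h : r ≤ d) (f : Fin d → ℝ)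
    (hf : ∀ k : Fin d, r ≤ (k : ℕ) → f k = 0) :
    ∑ k, f k = ∑ i : Fin r, f (Fin.castLE h i) := by
  obtain ⟨s, rfl⟩ := Nat.exists_eq_add_of_le h
  rw [Fin.sum_univ_add, Finset.sum_eq_zero (s := (Finset.univ : Finset (Fin s)))
    (fun i _ => hf _ (by simp)), add_zero]
  rfl

theorem mulVec_embed {d p : ℕ} (hpd : p + 1 ≤ d) (W : Matrix (Fin d) (Fin d) ℝ)
    (x : Fin p → ℝ) (k : Fin d) :
    W.mulVec (embed d p x) k =
      (∑ i, W k (Fin.castLE (Nat.le_of_succ_le hpd) i) * x i) + W k ⟨p, hpd⟩ := by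
  have hz : ∀ j : Fin d, p + 1 ≤ (j : ℕ) → W k j * embed d p x j = 0 := by
    intro j hj
    simp [embed, show ¬ (j : ℕ) < p by omega, show (j : ℕ) ≠ p by omega]
  rw [Matrix.mulVec, dotProduct, sum_castLE_of_eq_zero hpd _ hz, Fin.sum_univ_castSucc]
  congr 1
  · refine Finset.sum_congr rfl fun i _ => ?_
    simp only [embed, Fin.val_castLE, Fin.val_castSucc, Fin.is_lt, dite_true]
    rfl
  · simp only [embed, Fin.val_castLE, Fin.val_last, lt_irrefl, dite_false, if_true, mul_one]
    rfl

/-- The columns of the virtual weight matrices vanish beyond the support of the embeddings. -/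
theorem WPmat_eq_zero {d r T : ℕ} {u : Fin T → Fin d → ℝ} (hu : ∀ j, u j ∈ spanFirst d r)
    (w : Fin T → ℕ) (ℓ : ℕ) (k j : Fin d) (hj : r ≤ (j : ℕ)) : WPmat u w ℓ k j = 0 := by
  rw [WPmat, Matrix.sum_apply]
  refine Finset.sum_eq_zero fun t _ => ?_
  split_ifs with h
  · rw [vecMulVec_apply, hu _ j hj, mul_zero]
  · rfl
  · rfl

/-- A bias-free virtual network fed with an embedded input is a ReLU network whose width is
bounded by the common column support of its weight matrices. -/
theorem vnetOut_eq_nnHidden {d p r : ℕ} (hrd : r ≤ d) (hpd : p + 1 ≤ d)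
    (W : ℕ → Matrix (Fin d) (Fin d) ℝ)
    (hW : ∀ ℓ, 2 ≤ ℓ → ∀ k j : Fin d, r ≤ (j : ℕ) → W ℓ k j = 0)
    (x : Fin p → ℝ) (n : ℕ) (i : Fin r) :
    vnetOut d relu W (embed d p x) (n + 1) (Fin.castLE hrd i) =
      nnHidden (fun i j => W 1 (Fin.castLE hrd i) (Fin.castLE (Nat.le_of_succ_le hpd) j))
        (fun i => W 1 (Fin.castLE hrd i) ⟨p, hpd⟩)
        (fun n i j => W (n + 2) (Fin.castLE hrd i) (Fin.castLE hrd j)) (fun _ _ => 0) x n i := by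
  induction n generalizing i with
  | zero => exact mulVec_embed hpd (W 1) x _
  | succ n ih =>
    rw [vnetOut, Matrix.mulVec, dotProduct, sum_castLE_of_eq_zero hrd]
    · simp [nnHidden, ih, Matrix.mulVec, dotProduct]
    · intro k hk
      rw [hW (n + 1 + 1) (by omega) _ k hk, zero_mul]

theorem exists_mem_NNclass_eq_vnetOut {d p r L : ℕ} (hrd : r ≤ d) (hpd : p + 1 ≤ d)
    (hL : 0 < L) (W : ℕ → Matrix (Fin d) (Fin d) ℝ)
    (hW : ∀ ℓ, 2 ≤ ℓ → ∀ k j : Fin d, r ≤ (j : ℕ) → W ℓ k j = 0) (k : Fin d) :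
    (fun x => vnetOut d relu W (embed d p x) L k) ∈ NNclass r p L := by
  obtain rfl | ⟨n, rfl⟩ : L = 1 ∨ ∃ n, L = n + 2 := by
    rcases L with _ | _ | n
    · omega
    · exact Or.inl rfl
    · exact Or.inr ⟨n, rfl⟩
  · simp only [NNclass, Set.mem_ofPred_eq, if_true]
    exact ⟨_, _, funext fun x => mulVec_embed hpd (W 1) x k⟩
  · simp only [NNclass, Set.mem_ofPred_eq, show n + 2 ≠ 1 by omega, if_false,
      Nat.add_sub_cancel]
    refine ⟨fun i j => W 1 (Fin.castLE hrd i) (Fin.castLE (Nat.le_of_succ_le hpd) j),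
      fun i => W 1 (Fin.castLE hrd i) ⟨p, hpd⟩,
      fun n i j => W (n + 2) (Fin.castLE hrd i) (Fin.castLE hrd j), fun _ _ => 0,
      fun j => W (n + 2) k (Fin.castLE hrd j), 0, funext fun x => ?_⟩
    rw [vnetOut, Matrix.mulVec, dotProduct, sum_castLE_of_eq_zero hrd]
    · simp only [Nat.succ_ne_zero, if_false, vnetOut_eq_nnHidden hrd hpd W hW, add_zero]
    · intro j hj
      rw [hW (n + 1 + 1) (by omega) _ j hj, zero_mul]

theorem embed_mem_Icc {d p : ℕ} {x : Fin p → ℝ} (hx : x ∈ unitCube p) (k : Fin d) :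
    embed d p x k ∈ Set.Icc (0 : ℝ) 1 := by
  unfold embed
  split_ifs
  · exact ⟨hx.1 _, hx.2 _⟩
  · simp
  · simp

end PromptTF

/-- Every function realized by prompting with embeddings in
`U_{d,r}(B) = span{e_1,…,e_r} ∩ B_d(B)` agrees on `[0,1]^p` with a ReLU network of width `r`
and depth `L`. -/
theorem statement_18 (d : ℕ) (hd : 0 < d)
    (Θ : List (TFLayer (4 * d + 8))) (hΘ : EmulatesWith d (tfForward Θ) relu)
    (B : ℝ) (hB : 1 ≤ B) (p r : ℕ) (hp : 0 < p) (hpr : p ≤ r) (hrd : r ≤ d)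
    (hpd : p + 1 ≤ d) (T L : ℕ) (hT : 0 < T) (hL : 0 < L)
    (S : ℝ) (hS : max ((d : ℝ) * B ^ (4 * L) * (T : ℝ) ^ (2 * L)) (2 * (L : ℝ)) ≤ S)
    (T' : ℕ) (hT1 : 1 ≤ T') (hT2 : T' ≤ T)
    (u : Fin T' → Fin d → ℝ) (w : Fin T' → ℕ)
    (hval : ValidPrompt (spanFirst d r ∩ eball d B) T' L u w) :
    ∃ φ ∈ NNclass r p L,
      ∀ x ∈ unitCube p, fhat (tfForward Θ) u w S L p x = φ x := by
  refine ⟨fun x => vnetOut d relu (WPfam u w 0) (embed d p x) L ⟨0, hd⟩,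
    exists_mem_NNclass_eq_vnetOut hrd hpd hL _ (fun ℓ hℓ k j hj => ?_) _, fun x hx => ?_⟩
  · rw [WPfam, if_neg (by omega)]
    exact WPmat_eq_zero (fun t => (hval.1 t).1) w ℓ k j hj
  · have hS' : max ((d : ℝ) * B ^ (4 * L) * (T' : ℝ) ^ (2 * L)) (2 * (L : ℝ)) ≤ S := by
      refine le_trans ?_ hS
      gcongr
    have key := hΘ B hB T' L hT1 hL _ Set.inter_subset_right S hS' u w hval 1 one_pos
      (fun _ => embed d p x) (fun _ k => embed_mem_Icc hx k) 0 L hL le_rfl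
    have hidx : T' + 1 * L + ((0 : Fin 1) : ℕ) + 1 = T' + 1 + L := by simp; omega
    rw [hidx] at key
    rw [fhat, key]
    simp [promptToken, hd]
end
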